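/- arXiv:2101.02095 — 2 statements merged into one kernel-verified Lean document; each statement's English description precedes it below -/
import Mathlib

section
/- Let G be a type B strictly chordal graph with at least two distinct minimal vertex separators, and let S be a border minimal vertex separator of G with |S| > |B(S)|. Then S is not a subset of any scattering set of G. -/
open SimpleGraph

variable {V : Type*}

noncomputable def numComp (G : SimpleGraph V) (S : Set V) : ℕ :=
  Nat.card (G.induce Sᶜ).ConnectedComponent

def SeparatedBy (G : SimpleGraph V) (S : Set V) (u v : V) : Prop :=
  ∃ (hu : u ∈ Sᶜ) (hv : v ∈ Sᶜ), ¬ (G.induce Sᶜ).Reachable ⟨u, hu⟩ ⟨v, hv⟩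

def IsSeparator (G : SimpleGraph V) (S : Set V) : Prop :=
  ∃ u v, G.Reachable u v ∧ SeparatedBy G S u v

def IsMinimalSeparator (G : SimpleGraph V) (S : Set V) : Prop :=
  IsSeparator G S ∧ ∀ T ⊂ S, ¬ IsSeparator G T

def IsMVS (G : SimpleGraph V) (S : Set V) : Prop :=
  ∃ u v, u ≠ v ∧ ¬ G.Adj u v ∧ SeparatedBy G S u v ∧ ∀ T ⊂ S, ¬ SeparatedBy G T u v

def IsChordal (G : SimpleGraph V) : Prop :=
  ∀ n, 4 ≤ n → IsEmpty (cycleGraph n ↪g G)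

def StrictlyChordal (G : SimpleGraph V) : Prop :=
  G.Connected ∧ IsChordal G ∧
    ∀ S S' : Set V, IsMVS G S → IsMVS G S' → S ≠ S' → Disjoint S S'

noncomputable def sc [Finite V] (G : SimpleGraph V) : ℤ :=
  sSup {k : ℤ | ∃ S : Set V, numComp G S ≠ 1 ∧ k = (numComp G S : ℤ) - (Nat.card S : ℤ)}

noncomputable def toughness [Finite V] (G : SimpleGraph V) : ℝ :=
  sInf {t : ℝ | ∃ S : Set V, 1 < numComp G S ∧ t = (Nat.card S : ℝ) / (numComp G S : ℝ)}

def IsScatteringSet [Finite V] (G : SimpleGraph V) (S : Set V) : Prop :=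
  numComp G S ≠ 1 ∧ (numComp G S : ℤ) - (Nat.card S : ℤ) = sc G

def IsMaxClique (G : SimpleGraph V) (Q : Set V) : Prop :=
  G.IsClique Q ∧ ∀ R : Set V, G.IsClique R → Q ⊆ R → Q = R

def IsSimplicial (G : SimpleGraph V) (v : V) : Prop :=
  G.IsClique (G.neighborSet v)

def IsBoundaryClique (G : SimpleGraph V) (Q : Set V) : Prop :=
  IsMaxClique G Q ∧ (∃ v ∈ Q, IsSimplicial G v) ∧
    ∃ Q' : Set V, IsMaxClique G Q' ∧ Q' ≠ Q ∧ Q ∩ Q' = {v | v ∈ Q ∧ ¬ IsSimplicial G v}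

def BS (G : SimpleGraph V) (S : Set V) : Set (Set V) :=
  {Q | IsBoundaryClique G Q ∧ S ⊆ Q}

/-- `v` can be reached from `u` by a walk whose vertices after `u` all lie in `X`. -/
def ReachIn (G : SimpleGraph V) (X : Set V) (u v : V) : Prop :=
  Relation.ReflTransGen (fun a b => G.Adj a b ∧ b ∈ X) u v

namespace ReachIn

variable {G : SimpleGraph V} {X Y A : Set V} {u v w : V}

theorem mem (h : ReachIn G X u v) (hu : u ∈ A)
    (hA : ∀ a ∈ A, ∀ b ∈ X, G.Adj a b → b ∈ A) : v ∈ A := by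
  induction h with
  | refl => exact hu
  | tail _ hbc ih => exact hA _ ih _ hbc.2 hbc.1

theorem mono (h : ReachIn G X u v) (hXY : X ⊆ Y) : ReachIn G Y u v :=
  Relation.ReflTransGen.mono (fun _ _ hab => ⟨hab.1, hXY hab.2⟩) _ _ h

theorem trans (h : ReachIn G X u v) (h' : ReachIn G X v w) : ReachIn G X u w :=
  Relation.ReflTransGen.trans h h'

theorem mem_set (h : ReachIn G X u v) (hu : u ∈ X) : v ∈ X :=
  h.mem hu fun _ _ _ hb _ => hb

theorem of_adj (h : G.Adj u v) (hv : v ∈ X) : ReachIn G X u v :=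
  Relation.ReflTransGen.single ⟨h, hv⟩

theorem symm (h : ReachIn G X u v) (hu : u ∈ X) : ReachIn G X v u := by
  induction h with
  | refl => exact Relation.ReflTransGen.refl
  | tail hab hbc ih => exact (of_adj hbc.1.symm (mem_set hab hu)).trans ih

theorem within (h : ReachIn G X u v) : ReachIn G {x | ReachIn G X u x} u v := by
  induction h with
  | refl => exact Relation.ReflTransGen.refl
  | tail hab hbc ih =>
    exact ih.trans (of_adj hbc.1 (Relation.ReflTransGen.tail hab hbc))

end ReachIn

theorem reachable_induce_iff (G : SimpleGraph V) (X : Set V) {u v : V} (hu : u ∈ X) (hv : v ∈ X) :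
    (G.induce X).Reachable ⟨u, hu⟩ ⟨v, hv⟩ ↔ ReachIn G X u v := by
  constructor
  · intro h
    rw [SimpleGraph.reachable_iff_reflTransGen] at h
    exact h.lift Subtype.val fun a b hab => ⟨hab, b.2⟩
  · intro h
    have : v ∈ {x | ∃ hx : x ∈ X, (G.induce X).Reachable ⟨u, hu⟩ ⟨x, hx⟩} := by
      refine h.mem ⟨hu, SimpleGraph.Reachable.refl _⟩ ?_
      rintro a ⟨ha, hua⟩ b hb hab
      exact ⟨hb, hua.trans (SimpleGraph.Adj.reachable (G := G.induce X)
        (u := ⟨a, ha⟩) (v := ⟨b, hb⟩) hab)⟩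
    exact this.2

theorem separatedBy_iff (G : SimpleGraph V) (S : Set V) (u v : V) :
    SeparatedBy G S u v ↔ u ∉ S ∧ v ∉ S ∧ ¬ ReachIn G Sᶜ u v := by
  constructor
  · rintro ⟨hu, hv, h⟩
    exact ⟨hu, hv, fun h' => h ((reachable_induce_iff G Sᶜ hu hv).2 h')⟩
  · rintro ⟨hu, hv, h⟩
    exact ⟨hu, hv, fun h' => h ((reachable_induce_iff G Sᶜ hu hv).1 h')⟩

theorem exists_isMVS_subset [Finite V] {G : SimpleGraph V} {T₀ : Set V} {x y : V}
    (hne : x ≠ y) (hadj : ¬ G.Adj x y) (h : SeparatedBy G T₀ x y) :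
    ∃ T ⊆ T₀, IsMVS G T ∧ SeparatedBy G T x y := by
  obtain ⟨T, hT, hmin⟩ :=
    (Set.toFinite {T : Set V | SeparatedBy G T x y}).exists_le_minimal h
  exact ⟨T, hT, ⟨x, y, hne, hadj, hmin.prop, fun T' hT' h' =>
    hT'.2 (hmin.le_of_le h' hT'.1)⟩, hmin.prop⟩

/-- A common neighbour of two non-adjacent vertices lies in a minimal vertex separator
of these vertices. -/
theorem exists_isMVS_mem_of_common_neighbor [Finite V] {G : SimpleGraph V} {x y s : V}
    (hne : x ≠ y) (hadj : ¬ G.Adj x y) (hx : G.Adj x s) (hy : G.Adj s y) :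
    ∃ T, IsMVS G T ∧ SeparatedBy G T x y ∧ s ∈ T := by
  have h0 : SeparatedBy G ({x, y} : Set V)ᶜ x y := by
    rw [separatedBy_iff]
    refine ⟨by simp, by simp, fun h => ?_⟩
    have : y ∈ ({x} : Set V) := by
      refine h.mem rfl ?_
      rintro a rfl b hb hab
      simp only [compl_compl, Set.mem_insert_iff, Set.mem_singleton_iff] at hb
      rcases hb with rfl | rfl
      · rfl
      · exact absurd hab hadj
    exact hne (Set.mem_singleton_iff.1 this).symm
  obtain ⟨T, -, hT, hsep⟩ := exists_isMVS_subset hne hadj h0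
  refine ⟨T, hT, hsep, ?_⟩
  by_contra hs
  rw [separatedBy_iff] at hsep
  exact hsep.2.2 ((ReachIn.of_adj hx hs).trans (ReachIn.of_adj hy hsep.2.1))

theorem SeparatedBy.symm {G : SimpleGraph V} {S : Set V} {u v : V} (h : SeparatedBy G S u v) :
    SeparatedBy G S v u := by
  obtain ⟨hu, hv, h⟩ := h
  exact ⟨hv, hu, fun h' => h h'.symm⟩

/-- Every vertex of a minimal `uv`-separator has a neighbour in the component of `u`. -/
theorem exists_adj_of_minimal_separatedBy {G : SimpleGraph V} {S : Set V} {u v s : V}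
    (h : SeparatedBy G S u v) (hmin : ∀ T ⊂ S, ¬ SeparatedBy G T u v) (hs : s ∈ S) :
    ∃ a, ReachIn G Sᶜ u a ∧ G.Adj s a := by
  by_contra! hno
  have h1 := hmin (S \ {s}) (Set.sdiff_singleton_ssubset.2 hs)
  rw [separatedBy_iff] at h h1
  refine h1 ⟨fun h' => h.1 h'.1, fun h' => h.2.1 h'.1, fun hr => h.2.2 ?_⟩
  refine hr.mem (A := {x | ReachIn G Sᶜ u x}) Relation.ReflTransGen.refl ?_
  intro a ha b hb hab
  by_cases hbs : b = s
  · subst hbs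
    exact absurd hab.symm (hno a ha)
  · exact ReachIn.trans ha (ReachIn.of_adj hab fun hbS => hb ⟨hbS, hbs⟩)

theorem IsChordal.not_fourCycle {G : SimpleGraph V} (h : IsChordal G) {a b c d : V}
    (hab : G.Adj a b) (hbc : G.Adj b c) (hcd : G.Adj c d) (hda : G.Adj d a)
    (hac : ¬ G.Adj a c) (hbd : ¬ G.Adj b d) (hac' : a ≠ c) (hbd' : b ≠ d) : False := by
  have hinj : Function.Injective ![a, b, c, d] := by
    intro i j hij
    have := hab.ne
    have := hbc.ne
    have := hcd.ne
    have := hda.ne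
    fin_cases i <;> fin_cases j <;> simp_all
  refine (h 4 le_rfl).false ⟨⟨![a, b, c, d], hinj⟩, ?_⟩
  intro i j
  have := hab.symm
  have := hbc.symm
  have := hcd.symm
  have := hda.symm
  have : ¬ G.Adj c a := fun h => hac h.symm
  have : ¬ G.Adj d b := fun h => hbd h.symm
  fin_cases i <;> fin_cases j <;> simp_all [SimpleGraph.cycleGraph_adj] <;> decide

/-- A set of vertices through which `s` and `t` are connected, minimal for inclusion. -/
theorem exists_minimal_connecting [Finite V] {G : SimpleGraph V} {A : Set V} {s t : V}
    (h : ReachIn G (insert t A) s t) :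
    ∃ W ⊆ A, ReachIn G (insert t W) s t ∧ ∀ a ∈ W, ¬ ReachIn G (insert t (W \ {a})) s t := by
  obtain ⟨W, hW, hmin⟩ :=
    (Set.toFinite {W : Set V | ReachIn G (insert t W) s t}).exists_le_minimal h
  exact ⟨W, hW, hmin.prop, fun a ha h' => (hmin.le_of_le h' Set.sdiff_subset ha).2 rfl⟩

/-- Two non-adjacent vertices `s`, `t` connected through `A` and through `B`, without edges
between `A` and `B`: if no two minimal vertex separators meet, then `s` and `t` have a common
neighbour in `A`. -/
theorem exists_common_neighbor [Finite V] {G : SimpleGraph V} {A B : Set V} {s t : V}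
    (hdisj : ∀ S S' : Set V, IsMVS G S → IsMVS G S' → S ≠ S' → Disjoint S S')
    (hst : s ≠ t) (hadj : ¬ G.Adj s t) (htA : t ∉ A)
    (hedge : ∀ a ∈ A, ∀ b ∈ B, ¬ G.Adj a b)
    (hA : ReachIn G (insert t A) s t) (hB : ReachIn G (insert t B) s t) :
    ∃ a ∈ A, G.Adj s a ∧ G.Adj a t := by
  obtain ⟨W, hWA, hW, hWmin⟩ := exists_minimal_connecting hA
  obtain ⟨U, hUB, hU, hUmin⟩ := exists_minimal_connecting hB
  have hnonempty : ∀ X : Set V, ReachIn G (insert t X) s t → X.Nonempty := by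
    intro X hX
    by_contra hX'
    rw [Set.not_nonempty_iff_eq_empty] at hX'
    subst hX'
    have : t ∈ ({s} : Set V) := by
      refine hX.mem rfl ?_
      rintro a rfl b hb hab
      have : b = t := by simpa using hb
      exact absurd (this ▸ hab) hadj
    exact hst (Set.mem_singleton_iff.1 this).symm
  obtain ⟨b, hb⟩ := hnonempty U hU
  have key : ∀ a ∈ W, ∃ T, IsMVS G T ∧ a ∈ T ∧ b ∈ T ∧ ∀ a' ∈ W, a' ∈ T → a' = a := by
    intro a ha
    set K : Set V := {s, t} ∪ (W \ {a}) ∪ (U \ {b}) with hK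
    have hsep : SeparatedBy G Kᶜ s t := by
      rw [separatedBy_iff]
      refine ⟨by simp [hK], by simp [hK], fun hr => ?_⟩
      rw [compl_compl] at hr
      have hWa := hWmin a ha
      have hUb := hUmin b hb
      have htm : t ∈ {x | (x ∈ insert s W ∧ ReachIn G (insert t (W \ {a})) s x) ∨
          (x ∈ insert s U ∧ ReachIn G (insert t (U \ {b})) s x)} := by
        refine hr.mem (Or.inl ⟨Or.inl rfl, Relation.ReflTransGen.refl⟩) ?_
        intro x hx y hy hxy
        have stepW : ReachIn G (insert t (W \ {a})) s x → y ∈ insert t (W \ {a}) →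
            ReachIn G (insert t (W \ {a})) s y := fun h h' => h.trans (.of_adj hxy h')
        have stepU : ReachIn G (insert t (U \ {b})) s x → y ∈ insert t (U \ {b}) →
            ReachIn G (insert t (U \ {b})) s y := fun h h' => h.trans (.of_adj hxy h')
        rcases hy with (hy | hy) | hy
        · rcases hy with rfl | hy
          · exact Or.inl ⟨Or.inl rfl, Relation.ReflTransGen.refl⟩
          · have hy : y = t := hy
            subst hy
            rcases hx with hx | hx
            · exact absurd (stepW hx.2 (Or.inl rfl)) hWa
            · exact absurd (stepU hx.2 (Or.inl rfl)) hUb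
        · rcases hx with ⟨-, hx⟩ | ⟨hx | hx, -⟩
          · exact Or.inl ⟨Or.inr hy.1, stepW hx (Or.inr hy)⟩
          · subst hx
            exact Or.inl ⟨Or.inr hy.1, .of_adj hxy (Or.inr hy)⟩
          · exact absurd hxy.symm (hedge y (hWA hy.1) x (hUB hx))
        · rcases hx with ⟨hx | hx, -⟩ | ⟨-, hx⟩
          · subst hx
            exact Or.inr ⟨Or.inr hy.1, .of_adj hxy (Or.inr hy)⟩
          · exact absurd hxy (hedge x (hWA hx) y (hUB hy.1))
          · exact Or.inr ⟨Or.inr hy.1, stepU hx (Or.inr hy)⟩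
      rcases htm with h | h
      · exact hWa h.2
      · exact hUb h.2
    obtain ⟨T, hTK, hT, hTsep⟩ := exists_isMVS_subset hst hadj hsep
    rw [separatedBy_iff] at hTsep
    have hit : ∀ X : Set V, ReachIn G (insert t X) s t → ∃ x ∈ X, x ∈ T := by
      intro X hX
      by_contra! hno
      refine hTsep.2.2 (hX.mono ?_)
      rintro x (rfl | hx)
      · exact hTsep.2.1
      · exact hno x hx
    have hWT : ∀ a' ∈ W, a' ∈ T → a' = a := by
      intro a' ha' haT
      by_contra hne
      exact hTK haT (Or.inl (Or.inr ⟨ha', hne⟩))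
    have hUT : ∀ b' ∈ U, b' ∈ T → b' = b := by
      intro b' hb' hbT
      by_contra hne
      exact hTK hbT (Or.inr ⟨hb', hne⟩)
    obtain ⟨a', ha', haT⟩ := hit W hW
    obtain ⟨b', hb', hbT⟩ := hit U hU
    exact ⟨T, hT, hWT a' ha' haT ▸ haT, hUT b' hb' hbT ▸ hbT, hWT⟩
  obtain ⟨a, ha⟩ := hnonempty W hW
  have hWa : W = {a} := by
    refine Set.eq_singleton_iff_unique_mem.2 ⟨ha, fun a' ha' => ?_⟩
    obtain ⟨T, hT, haT, hbT, -⟩ := key a ha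
    obtain ⟨T', hT', -, hbT', huniq⟩ := key a' ha'
    by_contra hne
    refine Set.disjoint_left.1 (hdisj T T' hT hT' ?_) hbT hbT'
    rintro rfl
    exact hne (huniq a ha haT).symm
  subst hWa
  have haA : a ∈ A := hWA rfl
  refine ⟨a, haA, ?_, ?_⟩
  · by_contra hsa
    have : t ∈ ({s} : Set V) := by
      refine hW.mem rfl ?_
      rintro x rfl y hy hxy
      rcases hy with rfl | hy
      · exact absurd hxy hadj
      · exact absurd ((Set.mem_singleton_iff.1 hy) ▸ hxy) hsa
    exact hst (Set.mem_singleton_iff.1 this).symm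
  · by_contra hat
    have : t ∈ ({s, a} : Set V) := by
      refine hW.mem (Or.inl rfl) ?_
      intro x hx y hy hxy
      rcases hy with rfl | hy
      · rcases hx with rfl | hx
        · exact absurd hxy hadj
        · exact absurd ((Set.mem_singleton_iff.1 hx) ▸ hxy) hat
      · exact Or.inr hy
    rcases this with h | h
    · exact hst h.symm
    · exact htA ((Set.mem_singleton_iff.1 h) ▸ haA)

/-- Two vertices of a minimal separator are connected through the component of `u`. -/
theorem reachIn_component_of_minimal_separatedBy {G : SimpleGraph V} {S : Set V} {u v s t : V}
    (h : SeparatedBy G S u v) (hmin : ∀ T ⊂ S, ¬ SeparatedBy G T u v) (hs : s ∈ S) (ht : t ∈ S) :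
    ReachIn G (insert t {x | ReachIn G Sᶜ u x}) s t := by
  obtain ⟨a, ha, hsa⟩ := exists_adj_of_minimal_separatedBy h hmin hs
  obtain ⟨b, hb, htb⟩ := exists_adj_of_minimal_separatedBy h hmin ht
  have hab : ReachIn G {x | ReachIn G Sᶜ u x} a b :=
    (ha.within.symm Relation.ReflTransGen.refl).trans hb.within
  exact (ReachIn.of_adj hsa (Or.inr ha)).trans
    ((hab.mono (Set.subset_insert _ _)).trans (ReachIn.of_adj htb.symm (Or.inl rfl)))

theorem StrictlyChordal.isClique_of_isMVS [Finite V] {G : SimpleGraph V} (hG : StrictlyChordal G)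
    {S : Set V} (hS : IsMVS G S) : G.IsClique S := by
  intro s hs t ht hst
  by_contra hadj
  obtain ⟨u, v, -, -, hsep, hmin⟩ := hS
  have hsep' := hsep.symm
  have hmin' : ∀ T ⊂ S, ¬ SeparatedBy G T v u := fun T hT h => hmin T hT h.symm
  have hA := reachIn_component_of_minimal_separatedBy hsep hmin hs ht
  have hB := reachIn_component_of_minimal_separatedBy hsep' hmin' hs ht
  rw [separatedBy_iff] at hsep
  obtain ⟨hu, hv, hno⟩ := hsep
  have hAB : ∀ a, ReachIn G Sᶜ u a → ∀ b, ReachIn G Sᶜ v b → a ≠ b ∧ ¬ G.Adj a b := by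
    refine fun a ha b hb => ⟨?_, fun hab => ?_⟩
    · rintro rfl
      exact hno (ha.trans (hb.symm hv))
    · exact hno ((ha.trans (.of_adj hab (hb.mem_set hv))).trans (hb.symm hv))
  have hnot : ∀ w ∉ S, ∀ r ∈ S, r ∉ {x | ReachIn G Sᶜ w x} :=
    fun w hw r hr h => ReachIn.mem_set h hw hr
  obtain ⟨a, ha, hsa, hat⟩ := exists_common_neighbor hG.2.2 hst hadj (hnot u hu t ht)
    (fun a ha b hb => (hAB a ha b hb).2) hA hB
  obtain ⟨b, hb, hsb, hbt⟩ := exists_common_neighbor hG.2.2 hst hadj (hnot v hv t ht)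
    (fun b hb a ha h => (hAB a ha b hb).2 h.symm) hB hA
  exact hG.2.1.not_fourCycle hsa hat hbt.symm hsb.symm hadj (hAB a ha b hb).2 hst (hAB a ha b hb).1

/-- The vertices of a component of `G - S` with a neighbour in `S` form a clique. -/
theorem StrictlyChordal.adj_of_reachIn [Finite V] {G : SimpleGraph V} (hG : StrictlyChordal G)
    {S : Set V} (hS : IsMVS G S) {x y s t : V} (hx : x ∉ S) (hxy : ReachIn G Sᶜ x y)
    (hs : s ∈ S) (ht : t ∈ S) (hxs : G.Adj x s) (hyt : G.Adj y t) (hne : x ≠ y) :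
    G.Adj x y := by
  have hxt : G.Adj x t := by
    by_cases hst : s = t
    · exact hst ▸ hxs
    by_contra hadj
    have hxt : x ≠ t := fun h => hx (h ▸ ht)
    obtain ⟨T, hT, hsep, hsT⟩ :=
      exists_isMVS_mem_of_common_neighbor hxt hadj hxs (hG.isClique_of_isMVS hS hs ht hst)
    have hTS : T = S := by
      by_contra h
      exact Set.disjoint_left.1 (hG.2.2 T S hT hS h) hsT hs
    exact hsep.2.1 (hTS ▸ ht)
  by_contra hadj
  obtain ⟨T, hT, hsep, htT⟩ := exists_isMVS_mem_of_common_neighbor hne hadj hxt hyt.symm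
  have hTS : T = S := by
    by_contra h
    exact Set.disjoint_left.1 (hG.2.2 T S hT hS h) htT ht
  rw [hTS, separatedBy_iff] at hsep
  exact hsep.2.2 hxy

/-- Putting a minimal vertex separator `S` back into the graph merges at most `numComp G S`
components into one. -/
theorem StrictlyChordal.numComp_lt [Finite V] {G : SimpleGraph V} (hG : StrictlyChordal G)
    {S R : Set V} (hS : IsMVS G S) (hne : S.Nonempty) (hSR : S ⊆ R) :
    numComp G R < numComp G (R \ S) + numComp G S := by
  classical
  obtain ⟨s₀, hs₀⟩ := hne
  have hRS : Rᶜ ⊆ (R \ S)ᶜ := Set.compl_subset_compl.2 Set.sdiff_subset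
  have hRS' : Rᶜ ⊆ Sᶜ := Set.compl_subset_compl.2 hSR
  let P : (G.induce Rᶜ).ConnectedComponent → V → Prop := fun D x =>
    ∃ hx : x ∈ Rᶜ, (G.induce Rᶜ).connectedComponentMk ⟨x, hx⟩ = D
  have hrep : ∀ D, ∃ x, P D x ∧ ((∃ y s, P D y ∧ s ∈ S ∧ G.Adj y s) → ∃ s ∈ S, G.Adj x s) := by
    intro D
    by_cases h : ∃ y s, P D y ∧ s ∈ S ∧ G.Adj y s
    · obtain ⟨y, s, hy, hs, hys⟩ := h
      exact ⟨y, hy, fun _ => ⟨s, hs, hys⟩⟩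
    · obtain ⟨⟨x, hx⟩, hxD⟩ := D.exists_rep
      exact ⟨x, ⟨hx, hxD⟩, fun h' => absurd h' h⟩
  choose r hr hrS using hrep
  choose hrR hrD using hr
  have heq : ∀ D D', ReachIn G Rᶜ (r D) (r D') → D = D' := by
    intro D D' h
    rw [← hrD D, ← hrD D']
    exact SimpleGraph.ConnectedComponent.sound ((reachable_induce_iff G Rᶜ (hrR D) (hrR D')).2 h)
  have hclosed : ∀ D, (¬ ∃ s ∈ S, G.Adj (r D) s) → ∀ y, ReachIn G (R \ S)ᶜ (r D) y →
      ReachIn G Rᶜ (r D) y := by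
    intro D hD y hy
    refine hy.mem (A := {y | ReachIn G Rᶜ (r D) y}) Relation.ReflTransGen.refl ?_
    intro a ha b hb hab
    have haR : a ∈ Rᶜ := ReachIn.mem_set ha (hrR D)
    have hbR : b ∈ Rᶜ := by
      intro hbR
      have hbS : b ∈ S := by
        by_contra hbS
        exact hb ⟨hbR, hbS⟩
      refine hD (hrS D ⟨a, b, ⟨haR, ?_⟩, hbS, hab⟩)
      rw [← hrD D]
      exact SimpleGraph.ConnectedComponent.sound
        ((reachable_induce_iff G Rᶜ (hrR D) haR).2 ha).symm
    exact ReachIn.trans ha (.of_adj hab hbR)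
  have hs₀' : s₀ ∈ (R \ S)ᶜ := fun h => h.2 hs₀
  let f : Option (G.induce Rᶜ).ConnectedComponent →
      (G.induce (R \ S)ᶜ).ConnectedComponent ⊕ (G.induce Sᶜ).ConnectedComponent := fun o =>
    match o with
    | none => Sum.inl ((G.induce (R \ S)ᶜ).connectedComponentMk ⟨s₀, hs₀'⟩)
    | some D => if ∃ s ∈ S, G.Adj (r D) s
      then Sum.inr ((G.induce Sᶜ).connectedComponentMk ⟨r D, hRS' (hrR D)⟩)
      else Sum.inl ((G.induce (R \ S)ᶜ).connectedComponentMk ⟨r D, hRS (hrR D)⟩)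
  have hnone : ∀ D, f none ≠ f (some D) := by
    intro D h
    by_cases hD : ∃ s ∈ S, G.Adj (r D) s
    · simp [f, hD] at h
    · simp only [f, if_neg hD, Sum.inl.injEq, SimpleGraph.ConnectedComponent.eq] at h
      have h := (reachable_induce_iff G _ _ _).1 h.symm
      exact ReachIn.mem_set (hclosed D hD _ h) (hrR D) (hSR hs₀)
  have hf : Function.Injective f := by
    rintro (_ | D) (_ | D') h
    · rfl
    · exact absurd h (hnone D')
    · exact absurd h.symm (hnone D)
    · congr 1
      by_cases hD : ∃ s ∈ S, G.Adj (r D) s <;> by_cases hD' : ∃ s ∈ S, G.Adj (r D') s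
      · simp only [f, if_pos hD, if_pos hD', Sum.inr.injEq, SimpleGraph.ConnectedComponent.eq] at h
        have h := (reachable_induce_iff G _ _ _).1 h
        obtain ⟨s, hs, hDs⟩ := hD
        obtain ⟨t, ht, hDt⟩ := hD'
        by_cases hrr : r D = r D'
        · exact heq D D' (hrr ▸ Relation.ReflTransGen.refl)
        · exact heq D D' (.of_adj
            (hG.adj_of_reachIn hS (hRS' (hrR D)) h hs ht hDs hDt hrr) (hrR D'))
      · simp [f, hD, hD'] at h
      · simp [f, hD, hD'] at h
      · simp only [f, if_neg hD, if_neg hD', Sum.inl.injEq,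
          SimpleGraph.ConnectedComponent.eq] at h
        exact heq D D' (hclosed D hD _ ((reachable_induce_iff G _ _ _).1 h))
  have := Nat.card_le_card_of_injective f hf
  rw [Finite.card_option, Nat.card_sum] at this
  exact this

theorem sub_le_sc [Finite V] (G : SimpleGraph V) {T : Set V} (hT : numComp G T ≠ 1) :
    (numComp G T : ℤ) - (Nat.card T : ℤ) ≤ sc G := by
  refine le_csSup (Set.Finite.bddAbove ?_) ⟨T, hT, rfl⟩
  refine (Set.finite_range fun S : Set V => (numComp G S : ℤ) - (Nat.card S : ℤ)).subset ?_
  rintro k ⟨S, -, rfl⟩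
  exact ⟨S, rfl⟩

theorem statement15 {V : Type*} [Finite V] (G : SimpleGraph V)
    (hsc : StrictlyChordal G) (ht : toughness G < 1)
    (hB : ∃ S₀ : Set V, IsMVS G S₀ ∧ Nat.card S₀ + 1 < numComp G S₀)
    (h2 : ∃ S S' : Set V, IsMVS G S ∧ IsMVS G S' ∧ S ≠ S')
    (S : Set V) (hS : IsMVS G S)
    (hborder : Nat.card (BS G S) + 1 = numComp G S)
    (hgt : Nat.card (BS G S) < Nat.card S) :
    ∀ SC : Set V, IsScatteringSet G SC → ¬ S ⊆ SC := by
  rintro SC ⟨-, hSC⟩ hsub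
  have hne : S.Nonempty := by
    rw [Set.nonempty_iff_ne_empty]
    rintro rfl
    simp at hgt
  have hlt := hsc.numComp_lt hS hne hsub
  obtain ⟨S₀, -, hS₀⟩ := hB
  have hsc₀ := sub_le_sc G (T := S₀) (by omega)
  have hcard : Nat.card (SC \ S : Set V) + Nat.card S = Nat.card SC := by
    simpa only [Nat.card_coe_set_eq] using Set.ncard_sdiff_add_ncard_of_subset hsub
  by_cases h1 : numComp G (SC \ S) = 1
  · omega
  · have := sub_le_sc G h1
    omega
end

section
/- Let G be a type B strictly chordal graph with at least two distinct minimal vertex separators, and let S be a border minimal vertex separator of G with |S| = |B(S)|. Let G′ be the subgraph of G induced by V ∖ (U ∖ S), where U is the union of the vertex sets of the boundary cliques in B(S). Then sc(G) = sc(G′). -/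
open SimpleGraph

variable {V : Type*}

section Components

theorem SimpleGraph.Reachable.of_adj_closed {W : Type*} {H : SimpleGraph W} {P : W → Prop}
    (hP : ∀ u v, H.Adj u v → P u → P v) {x y : W} (h : H.Reachable x y) (hx : P x) : P y := by
  obtain ⟨p⟩ := h
  induction p with
  | nil => exact hx
  | cons hadj _ ih => exact ih (hP _ _ hadj hx)

/-- The number of connected components of the subgraph induced by `A`. -/
noncomputable def compCard (G : SimpleGraph V) (A : Set V) : ℕ :=
  Nat.card (G.induce A).ConnectedComponent

/-- Deleting vertices whose remaining neighbours form a clique does not disconnect anything. -/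
theorem reachable_induce_of_isClique_boundary (G : SimpleGraph V) {A B : Set V} (hAB : A ⊆ B)
    (hK : G.IsClique {x | x ∈ A ∧ ∃ w ∈ B \ A, G.Adj w x}) {a b : V} (ha : a ∈ A) (hb : b ∈ A)
    (h : (G.induce B).Reachable ⟨a, hAB ha⟩ ⟨b, hAB hb⟩) :
    (G.induce A).Reachable ⟨a, ha⟩ ⟨b, hb⟩ := by
  have key := h.of_adj_closed (P := fun v : B =>
    (∀ hv : v.1 ∈ A, (G.induce A).Reachable ⟨a, ha⟩ ⟨v.1, hv⟩) ∧
    (v.1 ∉ A → ∃ x, ∃ hx : x ∈ A, (G.induce A).Reachable ⟨a, ha⟩ ⟨x, hx⟩ ∧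
      ∃ w ∈ B \ A, G.Adj w x)) ?_ ⟨fun _ => .rfl, fun hn => absurd ha hn⟩
  · exact key.1 hb
  · rintro ⟨u, hu⟩ ⟨v, hv⟩ huv ⟨h1, h2⟩
    replace huv : G.Adj u v := huv
    by_cases huA : u ∈ A
    · refine ⟨fun hvA => (h1 huA).trans (Adj.reachable ?_), fun hvA =>
        ⟨u, huA, h1 huA, v, ⟨hv, hvA⟩, huv.symm⟩⟩
      exact huv
    · obtain ⟨x, hx, hax, w, hw, hwx⟩ := h2 huA
      refine ⟨fun hvA => ?_, fun _ => ⟨x, hx, hax, w, hw, hwx⟩⟩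
      by_cases hxv : x = v
      · subst hxv; exact hax
      · have hadj : G.Adj x v := hK ⟨hx, w, hw, hwx⟩ ⟨hvA, u, ⟨hu, huA⟩, huv⟩ hxv
        exact hax.trans (Adj.reachable (G := G.induce A) (u := ⟨x, hx⟩) (v := ⟨v, hvA⟩) hadj)

theorem compCard_le_of_isClique_boundary [Finite V] (G : SimpleGraph V) {A B : Set V}
    (hAB : A ⊆ B) (hK : G.IsClique {x | x ∈ A ∧ ∃ w ∈ B \ A, G.Adj w x}) :
    compCard G A ≤ compCard G B := by
  refine Nat.card_le_card_of_injective
    (ConnectedComponent.map (G.induceHomOfLE hAB).toHom) ?_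
  intro c d
  induction c using ConnectedComponent.ind
  induction d using ConnectedComponent.ind
  rename_i x y
  intro h
  exact ConnectedComponent.sound
    (reachable_induce_of_isClique_boundary G hAB hK x.2 y.2 (ConnectedComponent.exact h))

theorem compCard_le_of_dominating [Finite V] (G : SimpleGraph V) {A B : Set V}
    (hAB : A ⊆ B) (hd : ∀ b ∈ B \ A, ∃ a ∈ A, G.Adj b a) :
    compCard G B ≤ compCard G A := by
  refine Nat.card_le_card_of_surjective
    (ConnectedComponent.map (G.induceHomOfLE hAB).toHom) ?_
  intro c
  induction c using ConnectedComponent.ind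
  rename_i y
  by_cases hy : y.1 ∈ A
  · exact ⟨(G.induce A).connectedComponentMk ⟨y, hy⟩, rfl⟩
  · obtain ⟨a, ha, hya⟩ := hd y ⟨y.2, hy⟩
    refine ⟨(G.induce A).connectedComponentMk ⟨a, ha⟩, ConnectedComponent.sound ?_⟩
    exact Adj.reachable (G := G.induce B) (u := ⟨a, hAB ha⟩) hya.symm

/-- Adding vertices covered by a family of cliques creates at most one component per clique. -/
theorem compCard_le_add_card [Finite V] (G : SimpleGraph V) {A B : Set V}
    (hAB : A ⊆ B) (F : Set (Set V)) (hF : ∀ Q ∈ F, G.IsClique Q)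
    (hc : ∀ b ∈ B \ A, ∃ Q ∈ F, b ∈ Q) :
    compCard G B ≤ compCard G A + Nat.card F := by
  classical
  unfold compCard
  rw [← Nat.card_sum]
  let f : (G.induce A).ConnectedComponent ⊕ F → Option (G.induce B).ConnectedComponent :=
    Sum.elim (fun c => some (c.map (G.induceHomOfLE hAB).toHom))
      (fun Q => if h : ∃ b : B, b.1 ∈ Q.1 then
        some ((G.induce B).connectedComponentMk h.choose) else none)
  have hf : ∀ c, ∃ z, f z = some c := by
    intro c
    induction c using ConnectedComponent.ind
    rename_i y
    by_cases hy : y.1 ∈ A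
    · exact ⟨.inl ((G.induce A).connectedComponentMk ⟨y, hy⟩), rfl⟩
    · obtain ⟨Q, hQ, hyQ⟩ := hc y ⟨y.2, hy⟩
      have h : ∃ b : B, b.1 ∈ Q := ⟨y, hyQ⟩
      refine ⟨.inr ⟨Q, hQ⟩, ?_⟩
      simp only [f, Sum.elim_inr, dif_pos h]
      congr 1
      refine ConnectedComponent.sound ?_
      by_cases he : h.choose = y
      · rw [he]
      · exact Adj.reachable (G := G.induce B)
          (hF Q hQ h.choose_spec hyQ (fun h' => he (Subtype.ext h')))
  choose g hg using hf
  refine Nat.card_le_card_of_injective g fun c d hcd => ?_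
  have := hg c
  rw [hcd, hg d] at this
  exact (Option.some.inj this).symm

theorem numComp_induce (G : SimpleGraph V) (W : Set V) (S : Set W) :
    numComp (G.induce W) S = compCard G (W \ (Subtype.val '' S)) := by
  refine Nat.card_congr (Iso.connectedComponentEquiv ⟨⟨fun x => ⟨x.1.1, x.1.2, ?_⟩,
    fun x => ⟨⟨x.1, x.2.1⟩, fun h => x.2.2 ⟨_, h, rfl⟩⟩, fun _ => rfl, fun _ => rfl⟩, ?_⟩)
  · rintro ⟨y, hy, hyx⟩
    exact x.2 (by rwa [← Subtype.ext hyx])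
  · rfl

end Components

section ScatteringNumber

theorem scattering_values_finite [Finite V] (G : SimpleGraph V) :
    {k : ℤ | ∃ S : Set V, numComp G S ≠ 1 ∧
      k = (numComp G S : ℤ) - (Nat.card S : ℤ)}.Finite := by
  refine (Set.finite_range
    (fun S : Set V => (numComp G S : ℤ) - (Nat.card S : ℤ))).subset ?_
  rintro k ⟨S, -, rfl⟩
  exact ⟨S, rfl⟩

theorem le_sc [Finite V] (G : SimpleGraph V) {S : Set V} (h : numComp G S ≠ 1) :
    (numComp G S : ℤ) - (Nat.card S : ℤ) ≤ sc G :=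
  le_csSup (scattering_values_finite G).bddAbove ⟨S, h, rfl⟩

theorem exists_isScatteringSet [Finite V] (G : SimpleGraph V) :
    ∃ S, IsScatteringSet G S := by
  have hne : {k : ℤ | ∃ S : Set V, numComp G S ≠ 1 ∧
      k = (numComp G S : ℤ) - (Nat.card S : ℤ)}.Nonempty := by
    refine ⟨_, Set.univ, ?_, rfl⟩
    have : IsEmpty (G.induce (Set.univ : Set V)ᶜ).ConnectedComponent :=
      ⟨fun c => c.ind fun v => v.2 trivial⟩
    simp [numComp]
  obtain ⟨S, h1, h2⟩ := Int.csSup_mem hne (scattering_values_finite G).bddAbove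
  exact ⟨S, h1, h2.symm⟩

end ScatteringNumber

section Separators

theorem SeparatedBy.mem_of_common_neighbor {G : SimpleGraph V} {M : Set V} {x y s : V}
    (h : SeparatedBy G M x y) (hx : G.Adj s x) (hy : G.Adj s y) : s ∈ M := by
  obtain ⟨hxM, hyM, hn⟩ := h
  by_contra hs
  exact hn ((Adj.reachable (G := G.induce Mᶜ) (u := ⟨x, hxM⟩) (v := ⟨s, hs⟩) hx.symm).trans
    (Adj.reachable (G := G.induce Mᶜ) (u := ⟨s, hs⟩) (v := ⟨y, hyM⟩) hy))

theorem exists_isMVS_of_common_neighbor [Finite V] {G : SimpleGraph V} {x y s : V}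
    (hxy : x ≠ y) (hn : ¬ G.Adj x y) (hx : G.Adj s x) (hy : G.Adj s y) :
    ∃ M, IsMVS G M ∧ s ∈ M ∧ SeparatedBy G M x y := by
  have h0 : SeparatedBy G ({x, y}ᶜ : Set V) x y := by
    refine ⟨by simp, by simp, fun h => ?_⟩
    refine hxy (h.of_adj_closed (P := fun v => x = v.1) ?_ rfl)
    rintro ⟨u, hu⟩ ⟨v, hv⟩ huv rfl
    replace huv : G.Adj x v := huv
    simp only [compl_compl, Set.mem_insert_iff, Set.mem_singleton_iff] at hv
    rcases hv with rfl | rfl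
    · rfl
    · exact absurd huv hn
  obtain ⟨M, -, hM⟩ := (Set.toFinite {M | SeparatedBy G M x y}).exists_le_minimal h0
  exact ⟨M, ⟨x, y, hxy, hn, hM.prop, fun T hT hs => hT.2 (hM.2 hs hT.1)⟩,
    hM.prop.mem_of_common_neighbor hx hy, hM.prop⟩

theorem IsMVS.not_isSimplicial {G : SimpleGraph V} {S : Set V} (hS : IsMVS G S) {s : V}
    (hs : s ∈ S) : ¬ IsSimplicial G s := by
  intro hsim
  obtain ⟨u, v, -, -, ⟨hu, hv, hn⟩, hmin⟩ := hS
  refine hmin (S \ {s}) ⟨Set.sdiff_subset, fun h => (h hs).2 rfl⟩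
    ⟨fun h => hu h.1, fun h => hv h.1, fun h => hn ?_⟩
  refine reachable_induce_of_isClique_boundary G
    (Set.compl_subset_compl.2 Set.sdiff_subset) ?_ hu hv h
  have hmem : ∀ w ∈ (S \ {s})ᶜ \ Sᶜ, w = s := by
    rintro w ⟨h1, h2⟩
    by_contra hws
    exact h1 ⟨not_not.1 h2, hws⟩
  rintro x ⟨-, w, hw, hwx⟩ y ⟨-, w', hw', hwy⟩ hxy
  rw [hmem w hw] at hwx
  rw [hmem w' hw'] at hwy
  exact hsim hwx hwy hxy

theorem IsMVS.nonempty {G : SimpleGraph V} (hG : G.Connected) {S : Set V} (hS : IsMVS G S) :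
    S.Nonempty := by
  rw [Set.nonempty_iff_ne_empty]
  rintro rfl
  obtain ⟨u, v, -, -, ⟨hu, hv, hn⟩, -⟩ := hS
  refine hn ((hG.preconnected u v).of_adj_closed
    (P := fun w => ∃ hw : w ∈ (∅ : Set V)ᶜ, (G.induce ∅ᶜ).Reachable ⟨u, hu⟩ ⟨w, hw⟩) ?_
    ⟨hu, .rfl⟩).2
  rintro a b hab ⟨ha, hr⟩
  exact ⟨id, hr.trans (Adj.reachable (G := G.induce ∅ᶜ) (u := ⟨a, ha⟩) (v := ⟨b, id⟩) hab)⟩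

end Separators

section BoundaryCliques

theorem IsMaxClique.mem_of_adj_isSimplicial {G : SimpleGraph V} {Q : Set V}
    (hQ : IsMaxClique G Q) {q x : V} (hq : q ∈ Q) (hsim : IsSimplicial G q) (hx : G.Adj q x) :
    x ∈ Q := by
  have hins : G.IsClique (insert x Q) := by
    refine hQ.1.insert fun b hb hxb => ?_
    by_cases hqb : q = b
    · exact hqb ▸ hx.symm
    · exact hsim hx (hQ.1 hq hb hqb) hxb
  rw [hQ.2 _ hins (Set.subset_insert x Q)]
  exact Set.mem_insert x Q

theorem IsBoundaryClique.isMVS {G : SimpleGraph V} {Q : Set V} (hQ : IsBoundaryClique G Q) :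
    IsMVS G {v | v ∈ Q ∧ ¬ IsSimplicial G v} := by
  obtain ⟨hmax, ⟨v, hvQ, hv⟩, Q', hmax', hne, hint⟩ := hQ
  obtain ⟨w, hwQ', hwQ⟩ : ∃ w ∈ Q', w ∉ Q := by
    by_contra! h
    exact hne (hmax'.2 Q hmax.1 h)
  refine ⟨v, w, fun h => hwQ (h ▸ hvQ), fun h => hwQ (hmax.mem_of_adj_isSimplicial hvQ hv h),
    ⟨fun h => h.2 hv, fun h => hwQ h.1, fun h => ?_⟩, fun T hT hsep => ?_⟩
  · refine hwQ (h.of_adj_closed (P := fun x => x.1 ∈ Q) ?_ hvQ)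
    rintro ⟨a, ha⟩ ⟨b, hb⟩ hab haQ
    exact hmax.mem_of_adj_isSimplicial haQ (not_not.1 fun h => ha ⟨haQ, h⟩) hab
  · obtain ⟨n, hn, hnT⟩ := Set.exists_of_ssubset hT
    have hnQ' : n ∈ Q' := (hint.symm ▸ hn : n ∈ Q ∩ Q').2
    exact hnT (hsep.mem_of_common_neighbor (hmax.1 hn.1 hvQ fun h => hn.2 (h ▸ hv))
      (hmax'.1 hnQ' hwQ' fun h => hwQ (h ▸ hn.1)))

variable {G : SimpleGraph V} {S : Set V}

theorem StrictlyChordal.isSimplicial_of_mem_BS (hG : StrictlyChordal G) (hS : IsMVS G S)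
    {Q : Set V} (hQ : Q ∈ BS G S) {q : V} (hq : q ∈ Q) (hqS : q ∉ S) : IsSimplicial G q := by
  by_contra hns
  obtain ⟨s, hs⟩ := hS.nonempty hG.1
  have hne : {v | v ∈ Q ∧ ¬ IsSimplicial G v} ≠ S := fun h => hqS (h ▸ ⟨hq, hns⟩)
  exact Set.disjoint_left.1 (hG.2.2 _ _ hQ.1.isMVS hS hne)
    (show s ∈ {v | v ∈ Q ∧ ¬ IsSimplicial G v} from ⟨hQ.2 hs, hS.not_isSimplicial hs⟩) hs

theorem StrictlyChordal.mem_of_adj_BS (hG : StrictlyChordal G) (hS : IsMVS G S)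
    {Q : Set V} (hQ : Q ∈ BS G S) {q x : V} (hq : q ∈ Q) (hqS : q ∉ S) (hx : G.Adj q x) :
    x ∈ Q :=
  hQ.1.1.mem_of_adj_isSimplicial hq (hG.isSimplicial_of_mem_BS hS hQ hq hqS) hx

theorem StrictlyChordal.mem_of_reachable_BS (hG : StrictlyChordal G) (hS : IsMVS G S)
    {Q : Set V} (hQ : Q ∈ BS G S) {x y : (Sᶜ : Set V)} (hx : x.1 ∈ Q)
    (h : (G.induce Sᶜ).Reachable x y) : y.1 ∈ Q := by
  refine h.of_adj_closed (P := fun z => z.1 ∈ Q) ?_ hx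
  rintro ⟨a, ha⟩ ⟨b, hb⟩ hab haQ
  exact hG.mem_of_adj_BS hS hQ haQ ha hab

/-- At a border minimal vertex separator, the vertices outside the boundary cliques lie in a
single component. -/
theorem StrictlyChordal.not_separatedBy_of_border [Finite V] (hG : StrictlyChordal G)
    (hS : IsMVS G S) (hborder : Nat.card (BS G S) + 1 = numComp G S) {x y : V}
    (hx : x ∉ ⋃₀ BS G S) (hy : y ∉ ⋃₀ BS G S) : ¬ SeparatedBy G S x y := by
  rintro ⟨hxS, hyS, hn⟩
  have hv : ∀ Q : BS G S, ∃ v : (Sᶜ : Set V), v.1 ∈ Q.1 := by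
    rintro ⟨Q, hQ⟩
    obtain ⟨v, hvQ, hv⟩ := hQ.1.2.1
    exact ⟨⟨v, fun h => hS.not_isSimplicial h hv⟩, hvQ⟩
  choose v hv using hv
  let r : Option (Option (BS G S)) → (Sᶜ : Set V) := fun o =>
    o.elim ⟨x, hxS⟩ fun o => o.elim ⟨y, hyS⟩ v
  have hxv : ∀ Q, ¬ (G.induce Sᶜ).Reachable (v Q) ⟨x, hxS⟩ := fun Q h =>
    hx ⟨Q, Q.2, hG.mem_of_reachable_BS hS Q.2 (hv Q) h⟩
  have hyv : ∀ Q, ¬ (G.induce Sᶜ).Reachable (v Q) ⟨y, hyS⟩ := fun Q h =>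
    hy ⟨Q, Q.2, hG.mem_of_reachable_BS hS Q.2 (hv Q) h⟩
  have hvv : ∀ Q R, (G.induce Sᶜ).Reachable (v Q) (v R) → Q = R := by
    intro Q R h
    have hRQ : (v R).1 ∈ Q.1 := hG.mem_of_reachable_BS hS Q.2 (hv Q) h
    have hsub : Q.1 ⊆ R.1 := by
      intro z hz
      by_cases hzv : (v R).1 = z
      · exact hzv ▸ hv R
      · exact hG.mem_of_adj_BS hS R.2 (hv R) (v R).2 (Q.2.1.1.1 hRQ hz hzv)
    exact Subtype.ext (Q.2.1.1.2 _ R.2.1.1.1 hsub)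
  have hinj : Function.Injective fun o => (G.induce Sᶜ).connectedComponentMk (r o) := by
    intro o o' h
    replace h := ConnectedComponent.exact h
    match o, o', h with
    | none, none, _ => rfl
    | none, some none, h => exact absurd h hn
    | none, some (some Q), h => exact absurd h.symm (hxv Q)
    | some none, none, h => exact absurd h.symm hn
    | some none, some none, _ => rfl
    | some none, some (some Q), h => exact absurd h.symm (hyv Q)
    | some (some Q), none, h => exact absurd h (hxv Q)
    | some (some Q), some none, h => exact absurd h (hyv Q)
    | some (some Q), some (some R), h => rw [hvv Q R h]
  have := Nat.card_le_card_of_injective _ hinj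
  rw [Finite.card_option, Finite.card_option] at this
  change _ ≤ numComp G S at this
  omega

/-- At a border minimal vertex separator, the neighbours outside the boundary cliques form a
clique. -/
theorem StrictlyChordal.isClique_neighbors_of_border [Finite V] (hG : StrictlyChordal G)
    (hS : IsMVS G S) (hclique : G.IsClique S)
    (hborder : Nat.card (BS G S) + 1 = numComp G S) :
    G.IsClique {x | x ∉ ⋃₀ BS G S ∧ x ∉ S ∧ ∃ s ∈ S, G.Adj s x} := by
  have heqS : ∀ M s, IsMVS G M → s ∈ M → s ∈ S → M = S := by
    intro M s hM hsM hsS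
    by_contra hne
    exact Set.disjoint_left.1 (hG.2.2 _ _ hM hS hne) hsM hsS
  rintro x ⟨hxU, hxS, s, hs, hsx⟩ y ⟨hyU, hyS, s', hs', hsy'⟩ hxy
  have hsy : G.Adj s y := by
    by_cases hss : s' = s
    · exact hss ▸ hsy'
    · by_contra hna
      obtain ⟨M, hM, hsM, hsep⟩ := exists_isMVS_of_common_neighbor
        (show s ≠ y from fun h => hyS (h ▸ hs)) hna (hclique hs' hs hss) hsy'
      exact hsep.1 (heqS M s' hM hsM hs' ▸ hs)
  by_contra hna
  obtain ⟨M, hM, hsM, hsep⟩ := exists_isMVS_of_common_neighbor hxy hna hsx hsy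
  exact hG.not_separatedBy_of_border hS hborder hxU hyU (heqS M s hM hsM hs ▸ hsep)

end BoundaryCliques

theorem statement16 {V : Type*} [Finite V] (G : SimpleGraph V)
    (hsc : StrictlyChordal G) (ht : toughness G < 1)
    (hB : ∃ S₀ : Set V, IsMVS G S₀ ∧ Nat.card S₀ + 1 < numComp G S₀)
    (h2 : ∃ S S' : Set V, IsMVS G S ∧ IsMVS G S' ∧ S ≠ S')
    (S : Set V) (hS : IsMVS G S)
    (hborder : Nat.card (BS G S) + 1 = numComp G S)
    (heq : Nat.card S = Nat.card (BS G S)) :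
    sc G = sc (G.induce ((⋃₀ (BS G S) \ S)ᶜ)) := by
  obtain ⟨S₀, -, hS₀⟩ := hB
  have hsc2 : 2 ≤ sc G := by
    have := le_sc G (S := S₀) (by omega)
    omega
  obtain ⟨s₀, hs₀⟩ := hS.nonempty hsc.1
  have hcardS : 0 < Nat.card S := Nat.card_pos_iff.2 ⟨⟨⟨s₀, hs₀⟩⟩, inferInstance⟩
  obtain ⟨⟨Q₀, hQ₀⟩⟩ : Nonempty (BS G S) := (Nat.card_pos_iff.1 (heq ▸ hcardS)).1
  have hclique : G.IsClique S := hQ₀.1.1.1.subset hQ₀.2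
  have hSU : S ⊆ ⋃₀ BS G S := fun s hs => ⟨Q₀, hQ₀, hQ₀.2 hs⟩
  set U := ⋃₀ BS G S with hU
  set W : Set V := (U \ S)ᶜ with hW
  apply le_antisymm
  · obtain ⟨T, -, hT⟩ := exists_isScatteringSet G
    change (compCard G Tᶜ : ℤ) - _ = _ at hT
    have restrict : ∀ T' : Set V, compCard G (W \ T') ≠ 1 →
        (compCard G (W \ T') : ℤ) - Nat.card T' ≤ sc (G.induce W) := by
      intro T' h1
      have himg : Subtype.val '' (Subtype.val ⁻¹' T' : Set W) = W ∩ T' :=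
        Subtype.image_preimage_coe W T'
      have hnum : numComp (G.induce W) (Subtype.val ⁻¹' T') = compCard G (W \ T') := by
        rw [numComp_induce, himg, Set.sdiff_self_inter]
      have hle : Nat.card (Subtype.val ⁻¹' T' : Set W) ≤ Nat.card T' := by
        rw [← Nat.card_image_of_injective Subtype.val_injective, himg]
        exact Nat.card_mono T'.toFinite Set.inter_subset_right
      have := le_sc (G.induce W) (S := Subtype.val ⁻¹' T') (by rwa [hnum])
      rw [hnum] at this
      omega
    by_cases hST : S ⊆ T
    · have hA : Uᶜ \ T ⊆ W \ (T \ S) := fun x hx =>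
        ⟨fun h => hx.1 h.1, fun h => hx.2 h.1⟩
      have h1 : compCard G (Uᶜ \ T) ≤ compCard G (W \ (T \ S)) := by
        refine compCard_le_of_isClique_boundary G hA
          ((hsc.isClique_neighbors_of_border hS hclique hborder).subset ?_)
        rintro x ⟨hx, w, ⟨hw, hw'⟩, hwx⟩
        refine ⟨hx.1, fun h => hx.1 (hSU h), w, ?_, hwx⟩
        by_contra hwS
        exact hw' ⟨fun h => hw.1 ⟨h, hwS⟩, fun h => hw.2 ⟨h, hwS⟩⟩
      have h2 : compCard G Tᶜ ≤ compCard G (Uᶜ \ T) + Nat.card (BS G S) := by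
        refine compCard_le_add_card G (fun x hx => hx.2) (BS G S) (fun Q hQ => hQ.1.1.1) ?_
        rintro b ⟨hbT, hb⟩
        by_contra hbU
        exact hb ⟨hbU, hbT⟩
      have h3 : Nat.card (T \ S : Set V) + Nat.card S = Nat.card T :=
        Set.ncard_sdiff_add_ncard_of_subset hST
      have h4 := restrict (T \ S) (by omega)
      omega
    · obtain ⟨s, hsS, hsT⟩ := Set.not_subset.1 hST
      have h1 : compCard G Tᶜ ≤ compCard G (W \ T) := by
        refine compCard_le_of_dominating G (fun x hx => hx.2) ?_
        rintro b ⟨hbT, hb⟩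
        obtain ⟨⟨Q, hQ, hbQ⟩, hbS⟩ : b ∈ U \ S := by
          by_contra hbW
          exact hb ⟨hbW, hbT⟩
        exact ⟨s, ⟨fun h => h.2 hsS, hsT⟩, hQ.1.1.1 hbQ (hQ.2 hsS) fun h => hbS (h ▸ hsS)⟩
      have h2 := restrict T (by omega)
      omega
  · obtain ⟨T, hT1, hT⟩ := exists_isScatteringSet (G.induce W)
    rw [← hT]
    rw [numComp_induce] at hT1 ⊢
    rw [← Nat.card_image_of_injective Subtype.val_injective]
    set T' : Set V := Subtype.val '' T
    have h1 : compCard G (W \ T') ≤ numComp G T' := by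
      refine compCard_le_of_isClique_boundary G (fun x hx => hx.2) (hclique.subset ?_)
      rintro x ⟨hx, w, ⟨hwT, hw⟩, hwx⟩
      obtain ⟨⟨Q, hQ, hwQ⟩, hwS⟩ : w ∈ U \ S := by
        by_contra hwW
        exact hw ⟨hwW, hwT⟩
      by_contra hxS
      exact hx.1 ⟨⟨Q, hQ, hsc.mem_of_adj_BS hS hQ hwQ hwS hwx⟩, hxS⟩
    by_cases h0 : compCard G (W \ T') = 0
    · omega
    · have := le_sc G (S := T') (by omega)
      omega
end
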